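/- (Koshliakov's formula) For every real a > 0, γ − log(4π/a) + 4 ∑_{n=1}^∞ d(n) K_0(2πan) = (1/a) ( γ − log(4πa) + 4 ∑_{n=1}^∞ d(n) K_0(2πn/a) ), both series converging absolutely. -/

import Mathlib

open MeasureTheory Filter Real

/-- The modified Bessel function of the second kind `K_ν(x)` for real `ν` and `x > 0`,
`K_ν(x) = ∫_0^∞ e^{-x cosh t} cosh(ν t) dt`. -/
noncomputable def besselK (ν x : ℝ) : ℝ :=
  ∫ t in Set.Ioi (0:ℝ), Real.exp (-x * Real.cosh t) * Real.cosh (ν * t)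

/-- The number of positive divisors of `n`. -/
def numDiv (n : ℕ) : ℕ := n.divisors.card

/-- The one-sided theta series `∑_{n ≥ 1} exp (-π n² t)` in the exponential variable `t = exp u`. -/
noncomputable def expTheta (u : ℝ) : ℝ := (HurwitzZeta.evenKernel 0 (exp u) - 1) / 2

theorem hasSum_expTheta (u : ℝ) :
    HasSum (fun n : ℕ+ ↦ exp (-π * (n : ℝ) ^ 2 * exp u)) (expTheta u) := by
  have h := (HurwitzZeta.hasSum_nat_cosKernel₀ 0 (exp_pos u)).div_const 2
  rw [← Equiv.pnatEquivNat.symm.hasSum_iff, expTheta, HurwitzZeta.evenKernel_eq_cosKernel_of_zero]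
  simpa [Function.comp_def] using h

theorem continuous_expTheta : Continuous expTheta := by
  have h : Continuous fun u : ℝ ↦ HurwitzZeta.evenKernel 0 (exp u) :=
    (HurwitzZeta.continuousOn_evenKernel 0).comp_continuous continuous_exp fun u ↦ exp_pos u
  unfold expTheta
  fun_prop

theorem expTheta_neg (u : ℝ) :
    expTheta (-u) = exp (u / 2) * expTheta u + (exp (u / 2) - 1) / 2 := by
  have h := HurwitzZeta.evenKernel_functional_equation 0 (exp (-u))
  have h1 : 1 / exp (-u) ^ (1 / 2 : ℝ) = exp (u / 2) := by
    rw [← exp_mul, one_div, ← exp_neg]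
    ring_nf
  rw [h1, ← HurwitzZeta.evenKernel_eq_cosKernel_of_zero, one_div, ← exp_neg, neg_neg] at h
  rw [expTheta, expTheta, h]
  ring

theorem isBigO_expTheta (r : ℝ) : expTheta =O[atTop] fun u ↦ exp (r * u) := by
  obtain ⟨p, hp, h⟩ := HurwitzZeta.isBigO_atTop_evenKernel_sub 0
  have h2 := ((h.trans (isLittleO_exp_neg_mul_rpow_atTop hp r).isBigO).comp_tendsto
    tendsto_exp_atTop).const_mul_left (1 / 2)
  refine h2.congr (fun u ↦ ?_) fun u ↦ ?_
  · simp [expTheta]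
    ring
  · simp [← exp_mul, mul_comm]

theorem isBigO_expTheta_add (r b : ℝ) :
    (fun u ↦ expTheta (u + b)) =O[atTop] fun u ↦ exp (r * u) := by
  refine ((isBigO_expTheta r).comp_tendsto (tendsto_atTop_add_const_right _ b tendsto_id)).trans ?_
  refine ((Asymptotics.isBigO_refl (fun u ↦ exp (r * u)) atTop).const_mul_left
    (exp (r * b))).congr_left fun u ↦ ?_
  simp [← exp_add, mul_add, add_comm]

theorem integrableOn_expTheta_add_mul (r a b : ℝ) :
    IntegrableOn (fun u ↦ expTheta (u + b) * exp (r * u)) (Set.Ioi a) := by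
  refine integrable_of_isBigO_exp_neg one_pos (Continuous.continuousOn ?_) ?_
  · have := continuous_expTheta
    fun_prop
  · refine ((isBigO_expTheta_add (-1 - r) b).mul
      (Asymptotics.isBigO_refl (fun u ↦ exp (r * u)) atTop)).congr_right fun u ↦ ?_
    rw [← exp_add]
    ring_nf

theorem integrableOn_expTheta_add (a b : ℝ) :
    IntegrableOn (fun u ↦ expTheta (u + b)) (Set.Ioi a) := by
  simpa using integrableOn_expTheta_add_mul 0 a b

theorem isBigO_expTheta_sub (b : ℝ) :
    (fun u ↦ expTheta (b - u)) =O[atTop] fun u ↦ exp (1 / 2 * u) := by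
  have h1 : (fun u ↦ exp (-b / 2) * (exp (1 / 2 * u) * expTheta (u + -b))) =O[atTop]
      fun u ↦ exp (1 / 2 * u) := by
    refine (((Asymptotics.isBigO_refl (fun u ↦ exp (1 / 2 * u)) atTop).mul
      (isBigO_expTheta_add 0 (-b))).const_mul_left _).congr_right fun u ↦ ?_
    simp
  have h2 : (fun u ↦ exp (-b / 2) / 2 * exp (1 / 2 * u)) =O[atTop] fun u ↦ exp (1 / 2 * u) :=
    (Asymptotics.isBigO_refl _ _).const_mul_left _
  have h3 : (fun _ : ℝ ↦ (-1 / 2 : ℝ)) =O[atTop] fun u ↦ exp (1 / 2 * u) := by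
    refine Asymptotics.IsBigO.of_bound 1 ?_
    filter_upwards [eventually_ge_atTop 0] with u hu
    have : 1 ≤ exp (1 / 2 * u) := one_le_exp (by positivity)
    rw [norm_of_nonneg (exp_pos _).le]
    norm_num
    linarith
  refine ((h1.add h2).add h3).congr_left fun u ↦ ?_
  have h4 : exp ((u + -b) / 2) = exp (-b / 2) * exp (1 / 2 * u) := by
    rw [← exp_add]
    ring_nf
  rw [show b - u = -(u + -b) by ring, expTheta_neg, h4]
  ring

theorem integrable_expTheta_mul_expTheta (b : ℝ) :
    Integrable fun u ↦ expTheta (b + u) * expTheta (b - u) := by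
  have hc : Continuous fun u ↦ expTheta (b + u) * expTheta (b - u) := by
    have := continuous_expTheta
    fun_prop
  refine hc.locallyIntegrable.integrable_of_isBigO_atTop_of_norm_isNegInvariant
    (g := fun u ↦ exp (-1 * u)) (.of_forall fun u ↦ ?_) ?_ ?_
  · simp [mul_comm, sub_eq_add_neg]
  · refine ((isBigO_expTheta_add (-3 / 2) b).mul (isBigO_expTheta_sub b)).congr (fun u ↦ ?_)
      fun u ↦ ?_
    · rw [add_comm]
    · rw [← exp_add]
      ring_nf
  · exact ⟨_, Ioi_mem_atTop 0, integrableOn_exp_mul_Ioi (by norm_num) 0⟩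

theorem setIntegral_Ioi_comp_add (f : ℝ → ℝ) (b : ℝ) :
    ∫ u in Set.Ioi 0, f (u + b) = ∫ u in Set.Ioi b, f u := by
  have := (measurePreserving_add_right volume b).setIntegral_preimage_emb
    (measurableEmbedding_addRight b) f (Set.Ioi b)
  simpa using this

theorem two_mul_besselK_zero (x b : ℝ) :
    2 * besselK 0 x = ∫ u, exp (-x * cosh (u + b)) := by
  have := integral_comp_abs (f := fun u ↦ exp (-x * cosh u))
  simp only [cosh_abs] at this
  rw [integral_add_right_eq_self (fun u ↦ exp (-x * cosh u)) b, this]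
  simp [besselK]

theorem exp_mul_exp_eq_exp_cosh (b u : ℝ) {x y : ℝ} (hx : 0 < x) (hy : 0 < y) :
    exp (-π * x ^ 2 * exp (b + u)) * exp (-π * y ^ 2 * exp (b - u)) =
      exp (-(2 * π * exp b * (x * y)) * cosh (u + (log x - log y))) := by
  have h : -π * x ^ 2 * exp (b + u) + -π * y ^ 2 * exp (b - u) =
      -(2 * π * exp b * (x * y)) * cosh (u + (log x - log y)) := by
    rw [cosh_eq]
    simp only [neg_add, neg_sub, exp_add, exp_sub, exp_log hx, exp_log hy, exp_neg]
    field_simp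
    ring
  rw [← exp_add, h]

theorem hasSum_prod_besselK (b : ℝ) :
    HasSum (fun p : ℕ+ × ℕ+ ↦ 2 * besselK 0 (2 * π * exp b * ((p.1 : ℝ) * p.2)))
      (∫ u, expTheta (b + u) * expTheta (b - u)) := by
  have hsum (u : ℝ) : HasSum (fun p : ℕ+ × ℕ+ ↦
      exp (-(2 * π * exp b * ((p.1 : ℝ) * p.2)) * cosh (u + (log p.1 - log p.2))))
      (expTheta (b + u) * expTheta (b - u)) := by
    have h1 := hasSum_expTheta (b + u)
    have h2 := hasSum_expTheta (b - u)
    refine (h1.mul h2 (h1.summable.mul_of_nonneg h2.summable (fun _ ↦ (exp_pos _).le)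
      fun _ ↦ (exp_pos _).le)).congr_fun fun p ↦ ?_
    exact (exp_mul_exp_eq_exp_cosh b u (by exact_mod_cast p.1.pos)
      (by exact_mod_cast p.2.pos)).symm
  simp_rw [fun p : ℕ+ × ℕ+ ↦ two_mul_besselK_zero (2 * π * exp b * ((p.1 : ℝ) * p.2))
    (log p.1 - log p.2)]
  refine hasSum_integral_of_dominated_convergence (fun (p : ℕ+ × ℕ+) u ↦
    exp (-(2 * π * exp b * ((p.1 : ℝ) * p.2)) * cosh (u + (log p.1 - log p.2))))
    (fun p ↦ ?_) (fun p ↦ ?_) (.of_forall fun u ↦ (hsum u).summable) ?_ (.of_forall hsum)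
  · exact Continuous.aestronglyMeasurable (by fun_prop)
  · exact .of_forall fun u ↦ by simp
  · simp_rw [fun u ↦ (hsum u).tsum_eq]
    exact integrable_expTheta_mul_expTheta b

theorem hasSum_numDiv_mul {f : ℝ → ℝ} {c : ℝ}
    (h : HasSum (fun p : ℕ+ × ℕ+ ↦ f ((p.1 : ℝ) * p.2)) c) :
    HasSum (fun n : ℕ ↦ (numDiv (n + 1) : ℝ) * f (n + 1)) c := by
  rw [← sigmaAntidiagonalEquivProd.hasSum_iff] at h
  have h' := h.sigma fun n ↦ hasSum_fintype _
  rw [← Equiv.pnatEquivNat.symm.hasSum_iff] at h'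
  refine h'.congr_fun fun n ↦ ?_
  have hf (x : Nat.divisorsAntidiagonal (n + 1)) :
      f ((sigmaAntidiagonalEquivProd ⟨n.succPNat, x⟩).1 *
        (sigmaAntidiagonalEquivProd ⟨n.succPNat, x⟩).2) = f (n + 1) := by
    have hx := (Nat.mem_divisorsAntidiagonal.mp x.2).1
    congr 1
    exact_mod_cast hx
  have hcard : (Nat.divisorsAntidiagonal (n + 1)).card = numDiv (n + 1) := by
    rw [numDiv, ← Nat.map_div_right_divisors, Finset.card_map]
  trans ∑ x : Nat.divisorsAntidiagonal (n + 1), f (n + 1)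
  · simp [hcard]
  · exact Finset.sum_congr rfl fun x _ ↦ (hf x).symm

theorem hasSum_numDiv_mul_besselK (b : ℝ) :
    HasSum (fun n : ℕ ↦ (numDiv (n + 1) : ℝ) * besselK 0 (2 * π * exp b * (n + 1)))
      ((∫ u, expTheta (b + u) * expTheta (b - u)) / 2) := by
  refine hasSum_numDiv_mul (f := fun x ↦ besselK 0 (2 * π * exp b * x)) ?_
  simpa using (hasSum_prod_besselK b).div_const 2

theorem hurwitzEvenFEPair_f_modif_exp_of_pos {u : ℝ} (hu : 0 < u) :
    (HurwitzZeta.hurwitzEvenFEPair 0).f_modif (exp u) = ((2 * expTheta u : ℝ) : ℂ) := by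
  rw [WeakFEPair.f_modif, Pi.add_apply, Set.indicator_of_mem (by simpa using hu),
    Set.indicator_of_notMem (by simp [hu.le]), expTheta, mul_div_cancel₀ _ two_ne_zero]
  simp [HurwitzZeta.hurwitzEvenFEPair]

theorem hurwitzEvenFEPair_f_modif_exp_neg_of_pos {u : ℝ} (hu : 0 < u) :
    (HurwitzZeta.hurwitzEvenFEPair 0).f_modif (exp (-u)) =
      ((2 * exp (u / 2) * expTheta u : ℝ) : ℂ) := by
  have h : 2 * exp (u / 2) * expTheta u =
      HurwitzZeta.evenKernel 0 (exp (-u)) - exp (-u) ^ (-(1 / 2) : ℝ) := by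
    have h1 : expTheta (-u) = (HurwitzZeta.evenKernel 0 (exp (-u)) - 1) / 2 := rfl
    rw [← exp_mul, show -u * -(1 / 2) = u / 2 by ring]
    linear_combination 2 * h1 - 2 * expTheta_neg u
  rw [h, WeakFEPair.f_modif, Pi.add_apply, Set.indicator_of_notMem (by simp [hu.le]),
    Set.indicator_of_mem (Set.mem_Ioo.mpr ⟨exp_pos _, by simpa using hu⟩)]
  simp [HurwitzZeta.hurwitzEvenFEPair]

theorem integral_expTheta_mul_exp_add_integral_expTheta_zero :
    (∫ u in Set.Ioi 0, expTheta u * exp (1 / 2 * u)) + ∫ u in Set.Ioi 0, expTheta u =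
      (eulerMascheroniConstant - log (4 * π)) / 2 + 1 := by
  set h : ℝ → ℝ := fun u ↦ (Set.Iic 0).indicator (fun u ↦ expTheta (-u) * exp (1 / 2 * -u)) u +
    (Set.Ioi 0).indicator expTheta u with hh
  have hI1 : IntegrableOn (fun u ↦ expTheta (-u) * exp (1 / 2 * -u)) (Set.Iic 0) := by
    have := integrableOn_expTheta_add_mul (1 / 2) 0 0
    rw [← neg_zero, ← integrableOn_Ici_iff_integrableOn_Ioi] at this
    simpa using this.comp_neg
  have hI2 : IntegrableOn expTheta (Set.Ioi 0) := by simpa using integrableOn_expTheta_add 0 0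
  have hint : ∫ u, h u = (∫ u in Set.Ioi 0, expTheta u * exp (1 / 2 * u)) +
      ∫ u in Set.Ioi 0, expTheta u := by
    rw [hh, integral_add (hI1.integrable_indicator measurableSet_Iic)
      (hI2.integrable_indicator measurableSet_Ioi), integral_indicator measurableSet_Iic,
      integral_indicator measurableSet_Ioi]
    congr 1
    simpa using (integral_comp_neg_Ioi 0 fun u ↦ expTheta (-u) * exp (1 / 2 * -u)).symm
  have hz : completedRiemannZeta₀ 1 = ((∫ u, h u : ℝ) : ℂ) := by
    rw [completedRiemannZeta₀, HurwitzZeta.completedHurwitzZetaEven₀, WeakFEPair.Λ₀,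
      mellin_eq_fourier, fourier_eq', ← integral_complex_ofReal, ← integral_div]
    refine integral_congr_ae ?_
    filter_upwards [compl_mem_ae_iff.mpr (measure_singleton (0 : ℝ))] with u hu
    have hL : Complex.exp (↑(-2 * π * inner ℝ u ((1 / 2 : ℂ).im / (2 * π))) * Complex.I) = 1 := by
      simp
    have h2 : (HurwitzZeta.hurwitzEvenFEPair 0).f_modif (exp (-u)) =
        ((2 * exp (1 / 2 * u) * h u : ℝ) : ℂ) := by
      rcases lt_or_gt_of_ne hu with hu | hu
      · have h3 : exp (1 / 2 * u) * exp (1 / 2 * -u) = 1 := by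
          rw [← exp_add, exp_eq_one_iff]
          ring
        have h4 : h u = expTheta (-u) * exp (1 / 2 * -u) := by
          simp [hh, hu.le]
        rw [hurwitzEvenFEPair_f_modif_exp_of_pos (neg_pos.mpr hu), h4]
        congr 1
        linear_combination -2 * expTheta (-u) * h3
      · have h4 : h u = expTheta u := by
          simp [hh, hu, hu.not_ge]
        rw [hurwitzEvenFEPair_f_modif_exp_neg_of_pos hu, h4, show 1 / 2 * u = u / 2 by ring]
    have h3 : exp (-(1 / 2) * u) * exp (1 / 2 * u) = 1 := by
      rw [← exp_add, exp_eq_one_iff]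
      ring
    have h4 : (1 / 2 : ℂ).re = 1 / 2 := by norm_num
    rw [hL, h2, h4, one_smul, Complex.real_smul, ← Complex.ofReal_mul, ← Complex.ofReal_ofNat,
      ← Complex.ofReal_div]
    congr 1
    linear_combination h u * h3
  rw [← hint, ← Complex.ofReal_inj, ← hz, completedRiemannZeta₀_one]
  push_cast
  rw [Complex.ofReal_log (by positivity)]
  simp

theorem integral_expTheta_mul_exp_add_integral_expTheta (b : ℝ) :
    (∫ u in Set.Ioi (-b), expTheta u * exp (1 / 2 * u)) + ∫ u in Set.Ioi b, expTheta u =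
      (eulerMascheroniConstant - log (4 * π)) / 2 + b / 2 + exp (-b / 2) := by
  have hA (a : ℝ) : IntegrableOn (fun u ↦ expTheta u * exp (1 / 2 * u)) (Set.Ioi a) := by
    simpa using integrableOn_expTheta_add_mul (1 / 2) a 0
  have hB (a : ℝ) : IntegrableOn expTheta (Set.Ioi a) := by
    simpa using integrableOn_expTheta_add a 0
  have h1 := intervalIntegral.integral_Ioi_sub_Ioi' (hA (-b)) (hA 0)
  have h2 := intervalIntegral.integral_Ioi_sub_Ioi' (hB 0) (hB b)
  have h3 : ∫ u in -b..0, expTheta u * exp (1 / 2 * u) =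
      (∫ u in 0..b, expTheta u) + ∫ u in 0..b, (1 / 2 - exp (-1 / 2 * u) / 2) := by
    rw [← intervalIntegral.integral_add (continuous_expTheta.intervalIntegrable _ _)
      (Continuous.intervalIntegrable (by fun_prop) _ _)]
    trans ∫ u in 0..b, expTheta (-u) * exp (1 / 2 * -u)
    · simpa using
        (intervalIntegral.integral_comp_neg (a := 0) (b := b)
          fun u ↦ expTheta u * exp (1 / 2 * u)).symm
    refine intervalIntegral.integral_congr fun u _ ↦ ?_
    have h : exp (u / 2) * exp (-1 / 2 * u) = 1 := by
      rw [← exp_add, exp_eq_one_iff]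
      ring
    simp only [expTheta_neg, show 1 / 2 * -u = -1 / 2 * u by ring]
    linear_combination (expTheta u + 1 / 2) * h
  have h4 : ∫ u in 0..b, (1 / 2 - exp (-1 / 2 * u) / 2) = b / 2 + exp (-b / 2) - 1 := by
    rw [intervalIntegral.integral_sub (by simp) (Continuous.intervalIntegrable (by fun_prop) _ _),
      intervalIntegral.integral_div (2 : ℝ) fun u ↦ exp (-1 / 2 * u),
      intervalIntegral.integral_comp_mul_left exp (c := -1 / 2) (by norm_num),
      integral_exp, intervalIntegral.integral_const]
    simp only [mul_zero, exp_zero, smul_eq_mul, sub_zero]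
    ring_nf
  linarith [integral_expTheta_mul_exp_add_integral_expTheta_zero]

theorem integral_expTheta_mul_expTheta_neg (b : ℝ) :
    (∫ u, expTheta (-b + u) * expTheta (-b - u)) -
      exp b * ∫ u, expTheta (b + u) * expTheta (b - u) =
    exp b * (∫ u in Set.Ioi (-b), expTheta u * exp (1 / 2 * u)) -
      (∫ u in Set.Ioi (-b), expTheta u) - ((∫ u in Set.Ioi b, expTheta u * exp (1 / 2 * u)) -
      exp b * ∫ u in Set.Ioi b, expTheta u) := by
  have heven (c : ℝ) : ∫ u, expTheta (c + u) * expTheta (c - u) =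
      2 * ∫ u in Set.Ioi 0, expTheta (c + u) * expTheta (c - u) := by
    rw [← integral_comp_abs (f := fun u ↦ expTheta (c + u) * expTheta (c - u))]
    congr with u
    rcases abs_choice u with h | h <;> rw [h]
    rw [sub_neg_eq_add, ← sub_eq_add_neg, mul_comm]
  rw [heven, heven, ← setIntegral_Ioi_comp_add _ b, ← setIntegral_Ioi_comp_add _ b,
    ← setIntegral_Ioi_comp_add _ (-b), ← setIntegral_Ioi_comp_add _ (-b)]
  have h1 := (integrable_expTheta_mul_expTheta (-b)).integrableOn (s := Set.Ioi 0)
  have h2 := (integrable_expTheta_mul_expTheta b).integrableOn (s := Set.Ioi 0)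
  have hA (c : ℝ) : IntegrableOn (fun u ↦ expTheta (u + c) * exp (1 / 2 * (u + c)))
      (Set.Ioi 0) := by
    refine IntegrableOn.congr_fun ((integrableOn_expTheta_add_mul (1 / 2) 0 c).mul_const
      (exp (1 / 2 * c))) (fun u _ ↦ ?_) measurableSet_Ioi
    simp only [mul_add, exp_add, mul_assoc]
  have hB (c : ℝ) := integrableOn_expTheta_add 0 c
  have h3 := ((hA (-b)).const_mul (exp b)).sub (hB (-b))
  have h4 := (hA b).sub ((hB b).const_mul (exp b))
  simp only [← integral_const_mul]
  rw [← integral_sub (h1.const_mul 2) ((h2.const_mul 2).const_mul _),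
    ← integral_sub ((hA _).const_mul _) (hB _), ← integral_sub (hA _) ((hB _).const_mul _)]
  refine Eq.trans (setIntegral_congr_fun measurableSet_Ioi fun u _ ↦ ?_) (integral_sub h3 h4)
  have h5 : exp (1 / 2 * (u + b)) = exp ((u + b) / 2) := by ring_nf
  have h6 : exp b * exp (1 / 2 * (u + -b)) = exp ((u + b) / 2) := by
    rw [← exp_add]
    ring_nf
  have h7 : exp b * exp ((u - b) / 2) = exp ((u + b) / 2) := by
    rw [← exp_add]
    ring_nf
  simp only [h5, show -b - u = -(u + b) by ring, show b - u = -(u - b) by ring,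
    expTheta_neg, show -b + u = u - b by ring, show b + u = u + b by ring, ← sub_eq_add_neg] at h6 ⊢
  linear_combination -2 * expTheta (u + b) * expTheta (u - b) * h7 - expTheta (u + b) * h7 -
    expTheta (u - b) * h6

/-- **Koshliakov's formula.**  For every real `a > 0`,
`γ - log(4π/a) + 4 ∑_{n=1}^∞ d(n) K_0(2πan)
  = (1/a)(γ - log(4πa) + 4 ∑_{n=1}^∞ d(n) K_0(2πn/a))`,
both series converging absolutely. -/
theorem koshliakov_formula (a : ℝ) (ha : 0 < a) :
    Summable (fun n : ℕ => (numDiv (n+1) : ℝ) * besselK 0 (2 * Real.pi * a * (n+1))) ∧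
    Summable (fun n : ℕ => (numDiv (n+1) : ℝ) * besselK 0 (2 * Real.pi * (n+1) / a)) ∧
    Real.eulerMascheroniConstant - Real.log (4 * Real.pi / a)
        + 4 * ∑' n : ℕ, (numDiv (n+1) : ℝ) * besselK 0 (2 * Real.pi * a * (n+1))
      = (1/a) * (Real.eulerMascheroniConstant - Real.log (4 * Real.pi * a)
        + 4 * ∑' n : ℕ, (numDiv (n+1) : ℝ) * besselK 0 (2 * Real.pi * (n+1) / a)) := by
  obtain ⟨b, rfl⟩ : ∃ b, exp b = a := ⟨log a, exp_log ha⟩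
  have h1 := hasSum_numDiv_mul_besselK b
  have h2 : HasSum (fun n : ℕ ↦ (numDiv (n + 1) : ℝ) * besselK 0 (2 * π * (n + 1) / exp b))
      ((∫ u, expTheta (-b + u) * expTheta (-b - u)) / 2) := by
    refine (hasSum_numDiv_mul_besselK (-b)).congr_fun fun n ↦ ?_
    rw [exp_neg, div_eq_mul_inv, mul_right_comm]
  refine ⟨h1.summable, h2.summable, ?_⟩
  rw [h1.tsum_eq, h2.tsum_eq, log_div (by positivity) (by positivity),
    log_mul (by positivity) (exp_pos b).ne', log_exp, one_div,
    eq_inv_mul_iff_mul_eq₀ (exp_pos b).ne']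
  have h3 := integral_expTheta_mul_exp_add_integral_expTheta b
  have h4 := integral_expTheta_mul_exp_add_integral_expTheta (-b)
  rw [neg_neg] at h4
  have h5 : exp b * exp (-b / 2) = exp (b / 2) := by
    rw [← exp_add]
    ring_nf
  linear_combination -2 * integral_expTheta_mul_expTheta_neg b - 2 * exp b * h3 + 2 * h4 - 2 * h5
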